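/- Let A, N_1, …, N_q ∈ ℝ^{n×n}, B ∈ ℝ^{n×m}, C ∈ ℝ^{p×n}, and let K = (k_{ij}) ∈ ℝ^{q×q} be symmetric positive semidefinite. Let Σ = diag(Σ_r, Σ_{2}) be a positive definite diagonal matrix, r < n, with disjoint sets of diagonal entries of Σ_r and Σ_{2}, satisfying the Riccati equation AᵀΣ + ΣA + Σ_{i,j=1}^q N_iᵀ Σ N_j k_{ij} + CᵀC − ΣBBᵀΣ = 0, the Riccati inequality AᵀΣ⁻¹ + Σ⁻¹A + Σ_{i,j=1}^q N_iᵀ Σ⁻¹ N_j k_{ij} − CᵀC + Σ⁻¹BBᵀΣ⁻¹ ⪯ 0, and such that there exists Y ≻ 0 with (A−BBᵀΣ)ᵀY + Y(A−BBᵀΣ) + Σ_{i,j=1}^q N_iᵀ Y N_j k_{ij} ≺ 0. Let A_r, N_{i,r} be the leading r×r blocks of A, N_i and C_r the first r columns of C. Then the reduced triple (A_r, C_r, N_{i,r}) is detectable in the Hautus sense: for every real λ ≥ 0 and every symmetric positive semidefinite r×r matrix V ≠ 0 with A_r V + V A_rᵀ + Σ_{i,j=1}^q N_{i,r} V N_{j,r}ᵀ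 k_{ij} = λV, one has C_r V ≠ 0. -/

import Mathlib

open Matrix BigOperators

section TraceLemmas

open scoped MatrixOrder

variable {ι κ : Type*}

/-- A real positive semidefinite matrix is a Gram matrix. -/
theorem exists_transpose_mul_self_of_posSemidef [Fintype ι] [DecidableEq ι]
    {M : Matrix ι ι ℝ} (hM : M.PosSemidef) :
    ∃ R : Matrix ι ι ℝ, M = Rᵀ * R := by
  obtain ⟨R, hR⟩ := CStarAlgebra.nonneg_iff_eq_star_mul_self.mp hM.nonneg
  exact ⟨R, by rw [hR, star_eq_conjTranspose, conjTranspose_eq_transpose_of_trivial]⟩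

theorem transpose_eq_of_posSemidef {M : Matrix ι ι ℝ} (hM : M.PosSemidef) : Mᵀ = M := by
  rw [← conjTranspose_eq_transpose_of_trivial]
  exact hM.isHermitian

theorem posSemidef_congr [Fintype ι] [Fintype κ]
    {V : Matrix ι ι ℝ} (hV : V.PosSemidef) (G : Matrix κ ι ℝ) :
    (G * V * Gᵀ).PosSemidef := by
  simpa using hV.mul_mul_conjTranspose_same G

theorem trace_mul_eq_trace_gram [Fintype ι] (Q R : Matrix ι ι ℝ) :
    trace ((Qᵀ * Q) * (Rᵀ * R)) = trace ((Q * Rᵀ)ᴴ * (Q * Rᵀ)) := by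
  rw [conjTranspose_eq_transpose_of_trivial, transpose_mul, transpose_transpose,
    ← Matrix.mul_assoc, trace_mul_comm, ← Matrix.mul_assoc, ← Matrix.mul_assoc,
    ← Matrix.mul_assoc]

theorem trace_mul_nonneg_of_posSemidef [Fintype ι] [DecidableEq ι]
    {M V : Matrix ι ι ℝ} (hM : M.PosSemidef)
    (hV : V.PosSemidef) : 0 ≤ trace (M * V) := by
  obtain ⟨Q, rfl⟩ := exists_transpose_mul_self_of_posSemidef hM
  obtain ⟨R, rfl⟩ := exists_transpose_mul_self_of_posSemidef hV
  rw [trace_mul_eq_trace_gram]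
  exact (posSemidef_conjTranspose_mul_self _).trace_nonneg

theorem mul_eq_zero_of_trace_mul_eq_zero [Fintype ι] [DecidableEq ι]
    {M V : Matrix ι ι ℝ} (hM : M.PosSemidef)
    (hV : V.PosSemidef) (h : trace (M * V) = 0) : M * V = 0 := by
  obtain ⟨Q, rfl⟩ := exists_transpose_mul_self_of_posSemidef hM
  obtain ⟨R, rfl⟩ := exists_transpose_mul_self_of_posSemidef hV
  rw [trace_mul_eq_trace_gram, trace_conjTranspose_mul_self_eq_zero_iff] at h
  rw [Matrix.mul_assoc, ← Matrix.mul_assoc Q, h, Matrix.zero_mul, Matrix.mul_zero]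

theorem eq_zero_of_posDef_mul_eq_zero [Fintype ι] [DecidableEq ι]
    {M : Matrix ι ι ℝ} (hM : M.PosDef) {W : Matrix ι κ ℝ}
    (h : M * W = 0) : W = 0 := by
  have hu := (Matrix.isUnit_iff_isUnit_det M).mp hM.isUnit
  rw [← Matrix.one_mul W, ← nonsing_inv_mul M hu, Matrix.mul_assoc, h, Matrix.mul_zero]

theorem mul_eq_zero_of_congr_eq_zero [Fintype ι] [DecidableEq ι]
    {V : Matrix ι ι ℝ} (hV : V.PosSemidef)
    {G : Matrix κ ι ℝ} (h : G * V * Gᵀ = 0) : G * V = 0 := by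
  obtain ⟨R, rfl⟩ := exists_transpose_mul_self_of_posSemidef hV
  have h' : (G * Rᵀ) * (G * Rᵀ)ᴴ = 0 := by
    rw [← h]
    simp only [conjTranspose_eq_transpose_of_trivial, transpose_mul, transpose_transpose,
      Matrix.mul_assoc]
  rw [self_mul_conjTranspose_eq_zero] at h'
  rw [← Matrix.mul_assoc, h', Matrix.zero_mul]

end TraceLemmas

section Lyapunov

variable {n q : ℕ}

/-- The generalized Lyapunov operator `V ↦ A V + V Aᵀ + ∑ Nₗ V Nₗᵀ`. -/
def lyap (A : Matrix (Fin n) (Fin n) ℝ) (N : Fin q → Matrix (Fin n) (Fin n) ℝ)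
    (V : Matrix (Fin n) (Fin n) ℝ) : Matrix (Fin n) (Fin n) ℝ :=
  A * V + V * Aᵀ + ∑ l, N l * V * (N l)ᵀ

/-- The trace adjoint `Y ↦ Aᵀ Y + Y A + ∑ Nₗᵀ Y Nₗ` of `lyap`. -/
def lyapAdj (A : Matrix (Fin n) (Fin n) ℝ) (N : Fin q → Matrix (Fin n) (Fin n) ℝ)
    (Y : Matrix (Fin n) (Fin n) ℝ) : Matrix (Fin n) (Fin n) ℝ :=
  Aᵀ * Y + Y * A + ∑ l, (N l)ᵀ * Y * N l

theorem trace_lyapAdj_mul (A : Matrix (Fin n) (Fin n) ℝ)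
    (N : Fin q → Matrix (Fin n) (Fin n) ℝ) (Y V : Matrix (Fin n) (Fin n) ℝ) :
    trace (lyapAdj A N Y * V) = trace (Y * lyap A N V) := by
  simp only [lyap, lyapAdj, Matrix.add_mul, Matrix.mul_add, Matrix.sum_mul, Matrix.mul_sum,
    trace_add, trace_sum]
  have h1 : trace (Aᵀ * Y * V) = trace (Y * (V * Aᵀ)) := by
    rw [Matrix.mul_assoc, trace_mul_comm, Matrix.mul_assoc]
  have h2 : trace (Y * A * V) = trace (Y * (A * V)) := by rw [Matrix.mul_assoc]
  have h3 : ∀ l, trace ((N l)ᵀ * Y * N l * V) = trace (Y * (N l * V * (N l)ᵀ)) := by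
    intro l
    rw [Matrix.mul_assoc, Matrix.mul_assoc, trace_mul_comm, Matrix.mul_assoc]
  rw [h1, h2, Finset.sum_congr rfl fun l _ => h3 l]
  ring

/-- Block decomposition of a trace against a diagonal matrix. -/
theorem trace_diagonal_mul_split (d e : Fin n → ℝ) (he : ∀ i, e i * e i = e i)
    (M : Matrix (Fin n) (Fin n) ℝ) :
    trace (diagonal d * M) = trace (diagonal d * (diagonal e * M * diagonal e)) +
      trace (diagonal d * (diagonal (1 - e) * M * diagonal (1 - e))) := by
  simp only [trace, diag_apply, diagonal_mul, mul_diagonal, ← Finset.sum_add_distrib,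
    Pi.sub_apply, Pi.one_apply]
  refine Finset.sum_congr rfl fun i _ => ?_
  linear_combination (-2 * d i * M i i) * he i

variable {A : Matrix (Fin n) (Fin n) ℝ} {N : Fin q → Matrix (Fin n) (Fin n) ℝ}
  {V : Matrix (Fin n) (Fin n) ℝ} {e : Fin n → ℝ}

theorem compl_mul_of_mul_eq (hEV : diagonal e * V = V) : diagonal (1 - e) * V = 0 := by
  have : diagonal (1 - e) = 1 - diagonal e := by
    rw [← diagonal_one, diagonal_sub]; rfl
  rw [this, Matrix.sub_mul, Matrix.one_mul, hEV, sub_self]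

/-- The truncated diagonal block of `lyap A N V` when `V` is supported on the kept block. -/
theorem compl_lyap_compl (hV : V.PosSemidef) (hEV : diagonal e * V = V) :
    diagonal (1 - e) * lyap A N V * diagonal (1 - e) =
      ∑ l, (diagonal (1 - e) * N l) * V * (diagonal (1 - e) * N l)ᵀ := by
  have hFV := compl_mul_of_mul_eq hEV
  have hVF : V * diagonal (1 - e) = 0 := by
    rw [← transpose_eq_zero, transpose_mul, diagonal_transpose, transpose_eq_of_posSemidef hV,
      hFV]
  simp only [lyap, Matrix.add_mul, Matrix.mul_add, Matrix.sum_mul, Matrix.mul_sum,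
    transpose_mul, diagonal_transpose]
  have h1 : diagonal (1 - e) * (A * V) * diagonal (1 - e) = 0 := by
    rw [Matrix.mul_assoc, Matrix.mul_assoc, hVF, Matrix.mul_zero, Matrix.mul_zero]
  have h2 : diagonal (1 - e) * (V * Aᵀ) * diagonal (1 - e) = 0 := by
    rw [← Matrix.mul_assoc, hFV, Matrix.zero_mul, Matrix.zero_mul]
  rw [h1, h2, add_zero, zero_add]
  simp only [Matrix.mul_assoc]

/-- A nonzero undetectable eigenvector of the reduced operator has eigenvalue zero and
annihilates all the dissipation terms. -/
theorem undetectable_eigenvector {m p : ℕ} {B : Matrix (Fin n) (Fin m) ℝ}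
    {C : Matrix (Fin p) (Fin n) ℝ} {s x : Fin n → ℝ} (hs : ∀ i, 0 < s i) (hx : ∀ i, 0 < x i)
    (he : ∀ i, e i * e i = e i)
    (hric : lyapAdj A N (diagonal s) + Cᵀ * C -
      diagonal s * B * Bᵀ * diagonal s = 0)
    (hineq : (-(lyapAdj A N (diagonal x) - Cᵀ * C +
      diagonal x * B * Bᵀ * diagonal x)).PosSemidef)
    (hV : V.PosSemidef) (hV0 : V ≠ 0) (hEV : diagonal e * V = V) (hCV : C * V = 0)
    {c : ℝ} (hc : 0 ≤ c) (hL : diagonal e * lyap A N V * diagonal e = c • V) :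
    c = 0 ∧ (∀ l, diagonal (1 - e) * N l * V = 0) ∧ Bᵀ * diagonal x * V = 0 ∧
      Bᵀ * diagonal s * V = 0 ∧ lyapAdj A N (diagonal x) * V = 0 := by
  have hsD : (diagonal s).PosDef := PosDef.diagonal hs
  have hxD : (diagonal x).PosDef := PosDef.diagonal hx
  have hCCV : Cᵀ * C * V = 0 := by rw [Matrix.mul_assoc, hCV, Matrix.mul_zero]
  have hG : ∀ l, ((diagonal (1 - e) * N l) * V * (diagonal (1 - e) * N l)ᵀ).PosSemidef :=
    fun l => posSemidef_congr hV _
  have hB : ∀ d : Fin n → ℝ, trace (diagonal d * B * Bᵀ * diagonal d * V) =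
      trace (1 * ((Bᵀ * diagonal d) * V * (Bᵀ * diagonal d)ᵀ)) := by
    intro d
    simp only [Matrix.one_mul, transpose_mul, transpose_transpose, diagonal_transpose]
    rw [trace_mul_comm (Bᵀ * diagonal d * V)]
    simp only [Matrix.mul_assoc]
  have hBp : ∀ d : Fin n → ℝ, ((Bᵀ * diagonal d) * V * (Bᵀ * diagonal d)ᵀ).PosSemidef :=
    fun d => posSemidef_congr hV _
  have hBz : ∀ d : Fin n → ℝ, trace (diagonal d * B * Bᵀ * diagonal d * V) = 0 →
      Bᵀ * diagonal d * V = 0 := by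
    intro d h
    rw [hB] at h
    have := mul_eq_zero_of_trace_mul_eq_zero PosSemidef.one (hBp d) h
    rw [Matrix.one_mul] at this
    exact mul_eq_zero_of_congr_eq_zero hV this
  have hsplit : ∀ d : Fin n → ℝ, trace (lyapAdj A N (diagonal d) * V) =
      c * trace (diagonal d * V) + ∑ l, trace (diagonal d *
        ((diagonal (1 - e) * N l) * V * (diagonal (1 - e) * N l)ᵀ)) := by
    intro d
    rw [trace_lyapAdj_mul, trace_diagonal_mul_split d e he, hL, compl_lyap_compl hV hEV,
      Matrix.mul_smul, trace_smul, smul_eq_mul, Matrix.mul_sum, trace_sum]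
  have hMx := trace_mul_nonneg_of_posSemidef hineq hV
  have hMx' : trace (-(lyapAdj A N (diagonal x) - Cᵀ * C +
      diagonal x * B * Bᵀ * diagonal x) * V) = -(trace (lyapAdj A N (diagonal x) * V) +
        trace (diagonal x * B * Bᵀ * diagonal x * V)) := by
    rw [Matrix.neg_mul, Matrix.add_mul, Matrix.sub_mul, hCCV, sub_zero, trace_neg, trace_add]
  have hxV := trace_mul_nonneg_of_posSemidef hxD.posSemidef hV
  have hxN : ∀ l, 0 ≤ trace (diagonal x *
      ((diagonal (1 - e) * N l) * V * (diagonal (1 - e) * N l)ᵀ)) :=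
    fun l => trace_mul_nonneg_of_posSemidef hxD.posSemidef (hG l)
  have hxNs := Finset.sum_nonneg fun l (_ : l ∈ Finset.univ) => hxN l
  have hxB : 0 ≤ trace (diagonal x * B * Bᵀ * diagonal x * V) := by
    rw [hB]
    exact trace_mul_nonneg_of_posSemidef PosSemidef.one (hBp x)
  have hcx := mul_nonneg hc hxV
  have hxs := hsplit x
  have hxV0 : trace (diagonal x * V) ≠ 0 := fun h => hV0 <|
    eq_zero_of_posDef_mul_eq_zero hxD (mul_eq_zero_of_trace_mul_eq_zero hxD.posSemidef hV h)
  have hc0 : c = 0 := by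
    have : c * trace (diagonal x * V) = 0 := by linarith
    exact (mul_eq_zero.mp this).resolve_right hxV0
  have hN0 : ∀ l, diagonal (1 - e) * N l * V = 0 := by
    have hz : ∑ l, trace (diagonal x *
      ((diagonal (1 - e) * N l) * V * (diagonal (1 - e) * N l)ᵀ)) = 0 := by linarith
    intro l
    have hl := (Finset.sum_eq_zero_iff_of_nonneg fun l _ => hxN l).mp hz l (Finset.mem_univ l)
    exact mul_eq_zero_of_congr_eq_zero hV (eq_zero_of_posDef_mul_eq_zero hxD
      (mul_eq_zero_of_trace_mul_eq_zero hxD.posSemidef (hG l) hl))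
  have hBx0 : Bᵀ * diagonal x * V = 0 := hBz x (by linarith)
  have hBs0 : Bᵀ * diagonal s * V = 0 := by
    apply hBz
    have h := congrArg (fun M => trace (M * V)) hric
    simp only [Matrix.sub_mul, Matrix.add_mul, hCCV, add_zero, trace_sub, hsplit s, hc0,
      zero_mul, trace_zero, hN0, Matrix.mul_zero, Finset.sum_const_zero] at h
    linarith
  refine ⟨hc0, hN0, hBx0, hBs0, ?_⟩
  have h := mul_eq_zero_of_trace_mul_eq_zero hineq hV (by rw [hMx']; linarith)
  have hBB : diagonal x * B * Bᵀ * diagonal x * V = 0 := by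
    rw [Matrix.mul_assoc _ Bᵀ, Matrix.mul_assoc _ (Bᵀ * _), hBx0, Matrix.mul_zero]
  rwa [Matrix.neg_mul, Matrix.add_mul, Matrix.sub_mul, hCCV, sub_zero, hBB, add_zero,
    neg_eq_zero] at h

/-- The trace of the dissipation of `S` along `T V T` is a sum of squared commutators. -/
theorem trace_lyapAdj_mul_conj {S T : Matrix (Fin n) (Fin n) ℝ} (hS : Sᵀ = S) (hT : Tᵀ = T)
    (hST : T * S = S * T) (hVt : Vᵀ = V) (hX : lyapAdj A N (S * T) * V = 0)
    (hL : trace (S * T * T * lyap A N V) = 0) :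
    trace (lyapAdj A N S * (T * V * T)) =
      ∑ l, trace (S * ((T * N l - N l * T) * V * (T * N l - N l * T)ᵀ)) := by
  have hSTt : (S * T)ᵀ = S * T := by rw [transpose_mul, hS, hT, hST]
  have hXT := congrArg (fun M => trace (M * T)) hX
  simp only [lyap, lyapAdj, Matrix.add_mul, Matrix.mul_add, Matrix.sum_mul, Matrix.mul_sum,
    trace_add, trace_sum, Matrix.zero_mul, trace_zero] at hXT hL ⊢
  have a1 : trace (Aᵀ * S * (T * V * T)) = trace (Aᵀ * (S * T) * V * T) := by
    simp only [Matrix.mul_assoc]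
  have a2 : trace (S * A * (T * V * T)) = trace (Aᵀ * (S * T) * V * T) := by
    rw [← trace_transpose, ← a1]
    simp only [transpose_mul, hS, hT, hVt]
    rw [trace_mul_comm]
    simp only [Matrix.mul_assoc]
  have b1 : trace (S * T * T * (A * V)) = trace (S * T * A * V * T) := by
    rw [trace_mul_comm (S * T * A * V) T]
    simp only [← Matrix.mul_assoc, hST]
  have b2 : trace (S * T * T * (V * Aᵀ)) = trace (S * T * A * V * T) := by
    rw [← b1, ← trace_transpose]
    have h : (S * T * T)ᵀ = S * T * T := by
      rw [transpose_mul, hSTt, hT, ← Matrix.mul_assoc, hST]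
    rw [transpose_mul, transpose_mul, h, transpose_transpose, hVt, trace_mul_comm]
  have key : ∀ l, trace (S * ((T * N l - N l * T) * V * (T * N l - N l * T)ᵀ)) =
      trace (S * T * T * (N l * V * (N l)ᵀ)) - 2 * trace ((N l)ᵀ * (S * T) * N l * V * T) +
        trace ((N l)ᵀ * S * N l * (T * V * T)) := by
    intro l
    simp only [transpose_sub, transpose_mul, hT, Matrix.mul_sub, Matrix.sub_mul, trace_sub]
    have c1 : trace (S * (T * N l * V * ((N l)ᵀ * T))) =
        trace (S * T * T * (N l * V * (N l)ᵀ)) := by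
      rw [← Matrix.mul_assoc, ← Matrix.mul_assoc, trace_mul_comm]
      simp only [← Matrix.mul_assoc, hST]
    have c2 : trace (S * (T * N l * V * (T * (N l)ᵀ))) =
        trace ((N l)ᵀ * (S * T) * N l * V * T) := by
      simp only [Matrix.mul_assoc]
      rw [trace_mul_comm (N l)ᵀ]
      simp only [Matrix.mul_assoc]
    have c3 : trace (S * (N l * T * V * ((N l)ᵀ * T))) =
        trace ((N l)ᵀ * (S * T) * N l * V * T) := by
      rw [← c2, ← trace_transpose]
      simp only [transpose_mul, hS, hT, hVt, transpose_transpose]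
      rw [trace_mul_comm]
      simp only [Matrix.mul_assoc]
    have c4 : trace (S * (N l * T * V * (T * (N l)ᵀ))) =
        trace ((N l)ᵀ * S * N l * (T * V * T)) := by
      simp only [Matrix.mul_assoc]
      rw [trace_mul_comm (N l)ᵀ]
      simp only [Matrix.mul_assoc]
    rw [c1, c2, c3, c4]
    ring
  simp only [key, Finset.sum_add_distrib, Finset.sum_sub_distrib, ← Finset.mul_sum]
  rw [a1, a2]
  rw [b1, b2] at hL
  linarith

/-- Undetectable stationary matrices of the reduced system intertwine with `T = S⁻¹ X`, where
`S` solves the Riccati equation and `X` the Riccati inequality. -/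
theorem undetectable_commutes {m p : ℕ} {B : Matrix (Fin n) (Fin m) ℝ}
    {C : Matrix (Fin p) (Fin n) ℝ} {s t : Fin n → ℝ} (hs : ∀ i, 0 < s i) (ht : ∀ i, 0 < t i)
    (he : ∀ i, e i * e i = e i)
    (hric : lyapAdj A N (diagonal s) + Cᵀ * C -
      diagonal s * B * Bᵀ * diagonal s = 0)
    (hineq : (-(lyapAdj A N (diagonal (s * t)) - Cᵀ * C +
      diagonal (s * t) * B * Bᵀ * diagonal (s * t))).PosSemidef)
    (hV : V.PosSemidef) (hV0 : V ≠ 0) (hEV : diagonal e * V = V) (hCV : C * V = 0)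
    (hL : diagonal e * lyap A N V * diagonal e = 0) :
    C * (diagonal t * V) = 0 ∧ (∀ l, N l * diagonal t * V = diagonal t * N l * V) ∧
      A * diagonal t * V = diagonal t * A * V := by
  have hx : ∀ i, 0 < (s * t) i := fun i => mul_pos (hs i) (ht i)
  obtain ⟨-, hN, hBx, hBs, hX⟩ := undetectable_eigenvector hs hx he hric hineq hV hV0 hEV hCV
    le_rfl (by rw [hL, zero_smul])
  have hsD : (diagonal s).PosDef := PosDef.diagonal hs
  have hst : diagonal (s * t) = diagonal s * diagonal t := by rw [diagonal_mul_diagonal]; rfl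
  rw [hst] at hBx hX
  have hT : (diagonal t)ᵀ = diagonal t := diagonal_transpose t
  have hST : diagonal t * diagonal s = diagonal s * diagonal t := by
    simp only [diagonal_mul_diagonal, mul_comm]
  have hVt := transpose_eq_of_posSemidef hV
  have htrL : trace (diagonal s * diagonal t * diagonal t * lyap A N V) = 0 := by
    rw [diagonal_mul_diagonal, diagonal_mul_diagonal, trace_diagonal_mul_split _ e he, hL,
      compl_lyap_compl hV hEV]
    simp [hN]
  have hid := trace_lyapAdj_mul_conj (diagonal_transpose s) hT hST hVt hX htrL
  have hricT : lyapAdj A N (diagonal s) * (diagonal t * V) = -(Cᵀ * C * (diagonal t * V)) := by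
    have h := congrArg (· * (diagonal t * V)) hric
    have hB0 : diagonal s * B * Bᵀ * diagonal s * (diagonal t * V) = 0 := by
      calc _ = diagonal s * B * (Bᵀ * (diagonal s * diagonal t) * V) := by
            simp only [Matrix.mul_assoc]
        _ = 0 := by rw [hBx, Matrix.mul_zero]
    simp only [Matrix.sub_mul, Matrix.add_mul, hB0, sub_zero, Matrix.zero_mul] at h
    exact eq_neg_of_add_eq_zero_left h
  have hCp : ((C * diagonal t) * V * (C * diagonal t)ᵀ).PosSemidef := posSemidef_congr hV _
  have hCtr : trace (lyapAdj A N (diagonal s) * (diagonal t * V * diagonal t)) =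
      -trace (1 * ((C * diagonal t) * V * (C * diagonal t)ᵀ)) := by
    rw [← Matrix.mul_assoc, hricT, Matrix.neg_mul, trace_neg, Matrix.one_mul, transpose_mul, hT,
      trace_mul_comm (C * diagonal t * V), Matrix.mul_assoc Cᵀ, Matrix.mul_assoc Cᵀ,
      trace_mul_comm Cᵀ, trace_mul_comm (diagonal t * Cᵀ)]
    simp only [Matrix.mul_assoc]
  have hGp : ∀ l, ((diagonal t * N l - N l * diagonal t) * V *
      (diagonal t * N l - N l * diagonal t)ᵀ).PosSemidef := fun l => posSemidef_congr hV _
  have hnn : ∀ l, 0 ≤ trace (diagonal s * ((diagonal t * N l - N l * diagonal t) * V *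
      (diagonal t * N l - N l * diagonal t)ᵀ)) := fun l =>
    trace_mul_nonneg_of_posSemidef hsD.posSemidef (hGp l)
  have hsum := Finset.sum_nonneg fun l (_ : l ∈ Finset.univ) => hnn l
  have hC0 := trace_mul_nonneg_of_posSemidef PosSemidef.one hCp
  have hCTV : C * diagonal t * V = 0 := by
    refine mul_eq_zero_of_congr_eq_zero hV ?_
    have := mul_eq_zero_of_trace_mul_eq_zero PosSemidef.one hCp (by linarith)
    rwa [Matrix.one_mul] at this
  have hNT : ∀ l, N l * diagonal t * V = diagonal t * N l * V := by
    intro l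
    have hl := (Finset.sum_eq_zero_iff_of_nonneg fun l _ => hnn l).mp (by linarith) l
      (Finset.mem_univ l)
    have h0 := mul_eq_zero_of_congr_eq_zero hV (eq_zero_of_posDef_mul_eq_zero hsD
      (mul_eq_zero_of_trace_mul_eq_zero hsD.posSemidef (hGp l) hl))
    rw [Matrix.sub_mul, sub_eq_zero] at h0
    exact h0.symm
  have hCTV' : C * (diagonal t * V) = 0 := by rw [← Matrix.mul_assoc, hCTV]
  refine ⟨hCTV', hNT, ?_⟩
  rw [Matrix.mul_assoc Cᵀ, hCTV', Matrix.mul_zero, neg_zero] at hricT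
  have hdiff : diagonal s * (A * diagonal t * V - diagonal t * A * V) = 0 := by
    simp only [lyapAdj, Matrix.add_mul, Matrix.sum_mul] at hX hricT
    have hsm : ∑ l, (N l)ᵀ * diagonal s * N l * (diagonal t * V) =
        ∑ l, (N l)ᵀ * (diagonal s * diagonal t) * N l * V := by
      refine Finset.sum_congr rfl fun l _ => ?_
      calc _ = (N l)ᵀ * diagonal s * (N l * diagonal t * V) := by simp only [Matrix.mul_assoc]
        _ = _ := by rw [hNT]; simp only [Matrix.mul_assoc]
    rw [hsm] at hricT
    rw [← sub_eq_zero.mpr (hricT.trans hX.symm)]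
    simp only [Matrix.mul_sub, ← Matrix.mul_assoc]
    abel
  exact sub_eq_zero.mp (eq_zero_of_posDef_mul_eq_zero hsD hdiff)

/-- The class of undetectable stationary matrices is invariant under `V ↦ T V T`. -/
theorem lyap_conj {T : Matrix (Fin n) (Fin n) ℝ} (hT : Tᵀ = T) (hVt : Vᵀ = V)
    (hN : ∀ l, N l * T * V = T * N l * V) (hA : A * T * V = T * A * V) :
    lyap A N (T * V * T) = T * lyap A N V * T := by
  have hA' : V * T * Aᵀ = V * Aᵀ * T := by
    have := congrArg transpose hA
    simpa only [transpose_mul, hT, hVt, Matrix.mul_assoc] using this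
  have hN' : ∀ l, V * T * (N l)ᵀ = V * (N l)ᵀ * T := by
    intro l
    have := congrArg transpose (hN l)
    simpa only [transpose_mul, hT, hVt, Matrix.mul_assoc] using this
  simp only [lyap, Matrix.add_mul, Matrix.mul_add, Matrix.sum_mul, Matrix.mul_sum]
  congr 1
  · congr 1
    · rw [← Matrix.mul_assoc, ← Matrix.mul_assoc, hA, ← Matrix.mul_assoc]
    · rw [Matrix.mul_assoc T, Matrix.mul_assoc T, hA', Matrix.mul_assoc T]
  · refine Finset.sum_congr rfl fun l _ => ?_
    calc N l * (T * V * T) * (N l)ᵀ = (N l * T * V) * T * (N l)ᵀ := by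
          simp only [Matrix.mul_assoc]
      _ = T * N l * (V * T * (N l)ᵀ) := by rw [hN]; simp only [Matrix.mul_assoc]
      _ = _ := by rw [hN']; simp only [Matrix.mul_assoc]

/-- Undetectable stationary matrices of the reduced system intertwine with all powers of `T`. -/
theorem undetectable_commutes_pow {m p : ℕ} {B : Matrix (Fin n) (Fin m) ℝ}
    {C : Matrix (Fin p) (Fin n) ℝ} {s t : Fin n → ℝ} (hs : ∀ i, 0 < s i) (ht : ∀ i, 0 < t i)
    (he : ∀ i, e i * e i = e i)
    (hric : lyapAdj A N (diagonal s) + Cᵀ * C -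
      diagonal s * B * Bᵀ * diagonal s = 0)
    (hineq : (-(lyapAdj A N (diagonal (s * t)) - Cᵀ * C +
      diagonal (s * t) * B * Bᵀ * diagonal (s * t))).PosSemidef) (k : ℕ)
    (hV : V.PosSemidef) (hV0 : V ≠ 0) (hEV : diagonal e * V = V) (hCV : C * V = 0)
    (hL : diagonal e * lyap A N V * diagonal e = 0) :
    A * diagonal t ^ k * V = diagonal t ^ k * A * V := by
  induction k generalizing V with
  | zero => simp
  | succ k ih =>
    obtain ⟨hCT, hN, hA⟩ := undetectable_commutes hs ht he hric hineq hV hV0 hEV hCV hL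
    have htD : (diagonal t).PosDef := PosDef.diagonal ht
    have hT : (diagonal t)ᵀ = diagonal t := diagonal_transpose t
    have hVt := transpose_eq_of_posSemidef hV
    have hcomm : diagonal e * diagonal t = diagonal t * diagonal e := by
      simp only [diagonal_mul_diagonal, mul_comm]
    have hcancel : ∀ M : Matrix (Fin n) (Fin n) ℝ, M * diagonal t = 0 → M = 0 := by
      intro M hM
      have h := congrArg transpose hM
      rw [transpose_mul, hT, transpose_zero] at h
      exact transpose_eq_zero.mp (eq_zero_of_posDef_mul_eq_zero htD h)
    have hW : (diagonal t * V * diagonal t).PosSemidef := by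
      have := posSemidef_congr hV (diagonal t)
      rwa [hT] at this
    have h := ih hW
      (fun h0 => hV0 (eq_zero_of_posDef_mul_eq_zero htD (hcancel _ h0)))
      (by rw [← Matrix.mul_assoc, ← Matrix.mul_assoc, hcomm, Matrix.mul_assoc _ _ V, hEV])
      (by rw [← Matrix.mul_assoc, hCT, Matrix.zero_mul])
      (by
        rw [lyap_conj hT hVt hN hA]
        calc _ = (diagonal e * diagonal t) * lyap A N V * (diagonal t * diagonal e) := by
              simp only [Matrix.mul_assoc]
          _ = (diagonal t * diagonal e) * lyap A N V * (diagonal e * diagonal t) :=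
              congrArg₂ (fun P Q => P * lyap A N V * Q) hcomm hcomm.symm
          _ = diagonal t * (diagonal e * lyap A N V * diagonal e) * diagonal t := by
              simp only [Matrix.mul_assoc]
          _ = 0 := by rw [hL, Matrix.mul_zero, Matrix.zero_mul])
    refine sub_eq_zero.mp (hcancel _ ?_)
    rw [Matrix.sub_mul, sub_eq_zero]
    calc A * diagonal t ^ (k + 1) * V * diagonal t
        = A * diagonal t ^ k * (diagonal t * V * diagonal t) := by
          rw [pow_succ]; simp only [Matrix.mul_assoc]
      _ = diagonal t ^ k * (A * diagonal t * V) * diagonal t := by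
          rw [h]; simp only [Matrix.mul_assoc]
      _ = _ := by rw [hA, pow_succ]; simp only [Matrix.mul_assoc]

/-- If `A` intertwines with all powers of a diagonal matrix on the range of `V`, then it maps
this range into the span of the diagonal entries met by `V`. -/
theorem compl_mul_eq_zero_of_commutes_pow {t : Fin n → ℝ} (he : ∀ i, e i * e i = e i)
    (hdisj : ∀ i j, e i ≠ 0 → e j = 0 → t i ≠ t j) (hEV : diagonal e * V = V)
    (hpow : ∀ k : ℕ, A * diagonal t ^ k * V = diagonal t ^ k * A * V) :
    diagonal (1 - e) * (A * V) = 0 := by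
  have hpoly : ∀ (P : Polynomial ℝ) (i l : Fin n),
      ∑ j, A i j * P.eval (t j) * V j l = P.eval (t i) * ∑ j, A i j * V j l := by
    intro P i l
    induction P using Polynomial.induction_on' with
    | add P Q hP hQ =>
      simp only [Polynomial.eval_add, mul_add, add_mul, Finset.sum_add_distrib, hP, hQ]
    | monomial k a =>
      have h := congrFun (congrFun (hpow k) i) l
      rw [diagonal_pow, Matrix.mul_assoc (diagonal _), diagonal_mul, Matrix.mul_apply,
        Matrix.mul_apply] at h
      simp only [mul_diagonal, Pi.pow_apply] at h
      simp only [Polynomial.eval_monomial]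
      rw [mul_assoc a, ← h, Finset.mul_sum]
      exact Finset.sum_congr rfl fun j _ => by ring
  ext i l
  rw [diagonal_mul, Matrix.mul_apply, Matrix.zero_apply, Pi.sub_apply, Pi.one_apply]
  by_cases hi : e i = 0
  · have h := hpoly (∏ j with e j ≠ 0, (Polynomial.X - Polynomial.C (t j))) i l
    simp only [Polynomial.eval_prod, Polynomial.eval_sub, Polynomial.eval_X,
      Polynomial.eval_C] at h
    rw [Finset.sum_eq_zero, eq_comm, mul_eq_zero] at h
    · rw [h.resolve_left, mul_zero]
      refine Finset.prod_ne_zero_iff.mpr fun j hj => sub_ne_zero.mpr ?_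
      exact (hdisj j i (Finset.mem_filter.mp hj).2 hi).symm
    · intro j _
      by_cases hj : e j = 0
      · have hVj := congrFun (congrFun hEV j) l
        rw [diagonal_mul, hj, zero_mul] at hVj
        rw [← hVj, mul_zero]
      · rw [Finset.prod_eq_zero (Finset.mem_filter.mpr ⟨Finset.mem_univ j, hj⟩) (sub_self _),
          mul_zero, zero_mul]
  · have h1 : e i = 1 := mul_left_cancel₀ hi ((he i).trans (mul_one _).symm)
    rw [h1, sub_self, zero_mul]

/-- Hautus detectability of the truncated system, written with matrices of full size. -/
theorem truncated_detectable {m p : ℕ} {B : Matrix (Fin n) (Fin m) ℝ}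
    {C : Matrix (Fin p) (Fin n) ℝ} {s t : Fin n → ℝ} (hs : ∀ i, 0 < s i) (ht : ∀ i, 0 < t i)
    (he : ∀ i, e i * e i = e i) (hdisj : ∀ i j, e i ≠ 0 → e j = 0 → t i ≠ t j)
    (hric : lyapAdj A N (diagonal s) + Cᵀ * C -
      diagonal s * B * Bᵀ * diagonal s = 0)
    (hineq : (-(lyapAdj A N (diagonal (s * t)) - Cᵀ * C +
      diagonal (s * t) * B * Bᵀ * diagonal (s * t))).PosSemidef)
    {Y : Matrix (Fin n) (Fin n) ℝ} (hY : (-lyapAdj (A - B * Bᵀ * diagonal s) N Y).PosDef)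
    (hV : V.PosSemidef) (hV0 : V ≠ 0) (hEV : diagonal e * V = V)
    {c : ℝ} (hc : 0 ≤ c) (hL : diagonal e * lyap A N V * diagonal e = c • V) :
    C * V ≠ 0 := by
  intro hCV
  obtain ⟨rfl, hN, -, hBs, -⟩ := undetectable_eigenvector hs
    (fun i => mul_pos (hs i) (ht i) : ∀ i, 0 < (s * t) i) he hric hineq hV hV0 hEV hCV hc hL
  rw [zero_smul] at hL
  have hFA := compl_mul_eq_zero_of_commutes_pow he hdisj hEV fun k =>
    undetectable_commutes_pow hs ht he hric hineq k hV hV0 hEV hCV hL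
  have hVt := transpose_eq_of_posSemidef hV
  have hF : diagonal (1 - e) = 1 - diagonal e := by
    rw [← diagonal_one, diagonal_sub]; rfl
  have hEM : ∀ M : Matrix (Fin n) (Fin n) ℝ, diagonal (1 - e) * M = 0 → diagonal e * M = M := by
    intro M hM
    rw [hF, Matrix.sub_mul, Matrix.one_mul, sub_eq_zero] at hM
    exact hM.symm
  have hFL : diagonal (1 - e) * lyap A N V = 0 := by
    simp only [lyap, Matrix.mul_add, Matrix.mul_sum, hFA, ← Matrix.mul_assoc, hN,
      compl_mul_of_mul_eq hEV, Matrix.zero_mul, Finset.sum_const_zero, add_zero]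
  have hLt : (lyap A N V)ᵀ = lyap A N V := by
    simp only [lyap, transpose_add, transpose_sum, transpose_mul, transpose_transpose, hVt,
      Matrix.mul_assoc]
    rw [add_comm (V * Aᵀ)]
  have hLE : lyap A N V = 0 := by
    have h := hL
    rw [hEM _ hFL, ← transpose_eq_zero, transpose_mul, hLt, diagonal_transpose, hEM _ hFL] at h
    exact h
  have hBs' : B * Bᵀ * diagonal s * V = 0 := by
    rw [Matrix.mul_assoc B, Matrix.mul_assoc B, hBs, Matrix.mul_zero]
  have hcl : lyap (A - B * Bᵀ * diagonal s) N V = 0 := by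
    rw [← hLE]
    have h1 : (A - B * Bᵀ * diagonal s) * V = A * V := by
      rw [Matrix.sub_mul, hBs', sub_zero]
    have h2 : V * (A - B * Bᵀ * diagonal s)ᵀ = V * Aᵀ := by
      have := congrArg transpose h1
      rwa [transpose_mul, transpose_mul, hVt] at this
    rw [lyap, lyap, h1, h2]
  refine hV0 (eq_zero_of_posDef_mul_eq_zero hY
    (mul_eq_zero_of_trace_mul_eq_zero hY.posSemidef hV ?_))
  rw [Matrix.neg_mul, trace_neg, trace_lyapAdj_mul, hcl, Matrix.mul_zero, trace_zero, neg_zero]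

end Lyapunov

/-- Diagonalization of a sum weighted by a Gram matrix. -/
theorem sum_gram_smul_mul {ι α β γ δ : Type*} [Fintype ι] [Fintype β] [Fintype γ]
    (R : Matrix ι ι ℝ) (P : ι → Matrix α β ℝ) (Y : Matrix β γ ℝ) (Q : ι → Matrix γ δ ℝ) :
    ∑ i, ∑ j, (Rᵀ * R) i j • (P i * Y * Q j) =
      ∑ l, (∑ i, R l i • P i) * Y * (∑ j, R l j • Q j) := by
  have h : ∀ l, (∑ i, R l i • P i) * Y * (∑ j, R l j • Q j) =
      ∑ i, ∑ j, (R l i * R l j) • (P i * Y * Q j) := by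
    intro l
    simp only [Matrix.sum_mul, Matrix.mul_sum, Matrix.smul_mul, Matrix.mul_smul,
      Finset.smul_sum, smul_smul]
    rw [Finset.sum_comm]
    exact Finset.sum_congr rfl fun i _ => Finset.sum_congr rfl fun j _ => by rw [mul_comm]
  simp only [h, Matrix.mul_apply, transpose_apply, Finset.sum_smul]
  rw [Finset.sum_comm (s := (Finset.univ : Finset ι)) (f := fun l i =>
    ∑ j, (R l i * R l j) • (P i * Y * Q j))]
  exact Finset.sum_congr rfl fun i _ => Finset.sum_comm

/-- LQG balanced truncation preserves detectability (Hautus form) when the kept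
and truncated singular values are disjoint. -/
theorem stmt_12 {n m p q r : ℕ} (hr : r < n)
    (A : Matrix (Fin n) (Fin n) ℝ) (N : Fin q → Matrix (Fin n) (Fin n) ℝ)
    (B : Matrix (Fin n) (Fin m) ℝ) (C : Matrix (Fin p) (Fin n) ℝ)
    (K : Matrix (Fin q) (Fin q) ℝ) (hK : K.PosSemidef)
    (σ : Fin n → ℝ) (hσpos : ∀ i, 0 < σ i)
    (hdisj : ∀ i j : Fin n, (i : ℕ) < r → r ≤ (j : ℕ) → σ i ≠ σ j)
    (hric : Aᵀ * Matrix.diagonal σ + Matrix.diagonal σ * A +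
      (∑ i : Fin q, ∑ j : Fin q, K i j • ((N i)ᵀ * Matrix.diagonal σ * N j)) +
      Cᵀ * C - Matrix.diagonal σ * B * Bᵀ * Matrix.diagonal σ = 0)
    (hineq : (-(Aᵀ * (Matrix.diagonal σ)⁻¹ + (Matrix.diagonal σ)⁻¹ * A +
      (∑ i : Fin q, ∑ j : Fin q, K i j • ((N i)ᵀ * (Matrix.diagonal σ)⁻¹ * N j)) -
      Cᵀ * C + (Matrix.diagonal σ)⁻¹ * B * Bᵀ * (Matrix.diagonal σ)⁻¹)).PosSemidef)
    (hstab : ∃ Y : Matrix (Fin n) (Fin n) ℝ, Y.PosDef ∧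
      (-((A - B * Bᵀ * Matrix.diagonal σ)ᵀ * Y + Y * (A - B * Bᵀ * Matrix.diagonal σ) +
        ∑ i : Fin q, ∑ j : Fin q, K i j • ((N i)ᵀ * Y * N j))).PosDef) :
    ∀ l : ℝ, 0 ≤ l → ∀ V : Matrix (Fin r) (Fin r) ℝ, V.PosSemidef → V ≠ 0 →
      A.submatrix (Fin.castLE hr.le) (Fin.castLE hr.le) * V +
        V * (A.submatrix (Fin.castLE hr.le) (Fin.castLE hr.le))ᵀ +
        ∑ i : Fin q, ∑ j : Fin q,
          K i j • ((N i).submatrix (Fin.castLE hr.le) (Fin.castLE hr.le) * V *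
            ((N j).submatrix (Fin.castLE hr.le) (Fin.castLE hr.le))ᵀ) = l • V →
      C.submatrix id (Fin.castLE hr.le) * V ≠ 0 := by
  intro l hl V hV hV0 hL hCV
  obtain ⟨R, hR⟩ := exists_transpose_mul_self_of_posSemidef hK
  obtain ⟨Y, -, hY⟩ := hstab
  let M : Fin q → Matrix (Fin n) (Fin n) ℝ := fun k => ∑ i, R k i • N i
  have hM : ∀ k, (M k)ᵀ = ∑ i, R k i • (N i)ᵀ := fun k => by
    simp only [M, transpose_sum, transpose_smul]
  have hadj : ∀ A' Z : Matrix (Fin n) (Fin n) ℝ,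
      A'ᵀ * Z + Z * A' + ∑ i, ∑ j, K i j • ((N i)ᵀ * Z * N j) = lyapAdj A' M Z := by
    intro A' Z
    simp only [hR, sum_gram_smul_mul R (fun i => (N i)ᵀ) Z N, lyapAdj, hM]
    rfl
  let t : Fin n → ℝ := fun i => (σ i)⁻¹ * (σ i)⁻¹
  have ht : ∀ i, 0 < t i := fun i => mul_pos (inv_pos.mpr (hσpos i)) (inv_pos.mpr (hσpos i))
  have hinv : (diagonal σ)⁻¹ = diagonal (σ * t) := by
    refine inv_eq_right_inv ?_
    rw [diagonal_mul_diagonal, ← diagonal_one]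
    congr 1
    ext i
    have := (hσpos i).ne'
    simp only [Pi.mul_apply, t]
    field_simp
  rw [hinv, hadj] at hineq
  rw [hadj] at hric hY
  let e : Fin n → ℝ := fun i => if (i : ℕ) < r then 1 else 0
  have he : ∀ i, e i * e i = e i := fun i => by simp only [e]; split_ifs <;> norm_num
  have hdisj' : ∀ i j, e i ≠ 0 → e j = 0 → t i ≠ t j := by
    intro i j hi hj hij
    have hi' : (i : ℕ) < r := by by_contra h; exact hi (if_neg h)
    have hj' : r ≤ (j : ℕ) := by by_contra h; simp [e, not_le.mp h] at hj
    refine hdisj i j hi' hj' (inv_injective ?_)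
    exact (mul_self_inj (inv_pos.mpr (hσpos i)).le (inv_pos.mpr (hσpos j)).le).mp hij
  let J : Matrix (Fin n) (Fin r) ℝ := (1 : Matrix _ _ ℝ).submatrix id (Fin.castLE hr.le)
  have hsub : ∀ {a : ℕ} (X : Matrix (Fin a) (Fin n) ℝ),
      X.submatrix id (Fin.castLE hr.le) = X * J := by
    intro a X
    ext a b
    simp [J, Matrix.mul_apply, Matrix.one_apply]
  have hsub2 : ∀ X : Matrix (Fin n) (Fin n) ℝ,
      X.submatrix (Fin.castLE hr.le) (Fin.castLE hr.le) = Jᵀ * X * J := by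
    intro X
    rw [Matrix.mul_assoc, ← hsub]
    ext a b
    simp [J, Matrix.mul_apply, Matrix.one_apply]
  have hJJ : Jᵀ * J = 1 := by
    have := hsub2 1
    rw [Matrix.mul_one] at this
    rw [← this]
    exact submatrix_one _ (Fin.castLE_injective hr.le)
  have hJE : J * Jᵀ = diagonal e := by
    ext a b
    simp only [J, e, Matrix.mul_apply, transpose_apply, submatrix_apply, id, Matrix.one_apply,
      diagonal_apply]
    by_cases ha : (a : ℕ) < r
    · rw [Finset.sum_eq_single ⟨a, ha⟩]
      · simp [ha, eq_comm]
      · intro c _ hc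
        have : a ≠ Fin.castLE hr.le c := fun h => hc (Fin.ext (by simp [h]))
        simp [this]
      · simp
    · refine (Finset.sum_eq_zero fun c _ => ?_).trans (by simp [ha])
      have : a ≠ Fin.castLE hr.le c := fun h => ha (by simp [h])
      simp [this]
  have hEJ : diagonal e * J = J := by
    rw [← hJE, Matrix.mul_assoc, hJJ, Matrix.mul_one]
  have hback : Jᵀ * (J * V * Jᵀ) * J = V := by
    calc _ = (Jᵀ * J) * V * (Jᵀ * J) := by simp only [Matrix.mul_assoc]
      _ = V := by rw [hJJ, Matrix.one_mul, Matrix.mul_one]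
  refine truncated_detectable (V := J * V * Jᵀ) (C := C) hσpos ht he hdisj' hric hineq hY
    (posSemidef_congr hV J) (fun h => hV0 ?_)
    (by rw [← Matrix.mul_assoc, ← Matrix.mul_assoc, hEJ]) hl ?_ ?_
  · rw [← hback, h, Matrix.mul_zero, Matrix.zero_mul]
  · have hsum : ∑ i, ∑ j, K i j • ((Jᵀ * N i * J) * V * (Jᵀ * N j * J)ᵀ) =
        Jᵀ * (∑ k, M k * (J * V * Jᵀ) * (M k)ᵀ) * J := by
      have h := sum_gram_smul_mul R N (J * V * Jᵀ) (fun j => (N j)ᵀ)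
      rw [← hR] at h
      simp only [hM]
      rw [← h]
      simp only [Matrix.mul_sum, Matrix.sum_mul, Matrix.mul_smul, Matrix.smul_mul, transpose_mul,
        transpose_transpose, Matrix.mul_assoc]
    have hLr : Jᵀ * lyap A M (J * V * Jᵀ) * J = l • V := by
      rw [← hL]
      simp only [hsub2]
      rw [hsum]
      simp only [lyap, Matrix.mul_add, Matrix.add_mul, transpose_mul,
        transpose_transpose]
      congr 2
      · calc _ = Jᵀ * A * J * V * (Jᵀ * J) := by simp only [Matrix.mul_assoc]
          _ = _ := by rw [hJJ, Matrix.mul_one]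
      · calc _ = (Jᵀ * J) * V * (Jᵀ * Aᵀ * J) := by simp only [Matrix.mul_assoc]
          _ = _ := by rw [hJJ, Matrix.one_mul, Matrix.mul_assoc Jᵀ]
    calc _ = J * (Jᵀ * lyap A M (J * V * Jᵀ) * J) * Jᵀ := by
          rw [← hJE]; simp only [Matrix.mul_assoc]
      _ = _ := by rw [hLr, Matrix.mul_smul, Matrix.smul_mul]
  · rw [hsub] at hCV
    rw [← Matrix.mul_assoc, ← Matrix.mul_assoc, hCV, Matrix.zero_mul]
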